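/- Let G be a finite simple graph on n vertices with chromatic number χ(G) ≥ n − 3, and for each i let a_i denote the number of partitions of the vertex set of G into exactly i nonempty independent sets. Then the sequence (a_i) is log-concave: a_i² ≥ a_{i−1} · a_{i+1} for all i ≥ 1. -/

import Mathlib

open Polynomial

/-- `numIndepPartitions G i` is the number of partitions of the vertex set of `G` into
exactly `i` nonempty independent sets, encoded as the number of setoids (equivalence
relations) on `V` with exactly `i` equivalence classes, each class being an independent
set of `G`. -/
noncomputable def numIndepPartitions {V : Type*} (G : SimpleGraph V) (i : ℕ) : ℕ :=
  Nat.card {P : Setoid V // Nat.card (Quotient P) = i ∧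
    ∀ c ∈ P.classes, c.Pairwise fun u v => ¬ G.Adj u v}

/-- The σ-polynomial of a finite simple graph `G`: `σ(G,x) = ∑ aᵢ xⁱ` where `aᵢ` is the
number of partitions of the vertex set of `G` into `i` nonempty independent sets. -/
noncomputable def sigmaPoly {V : Type*} [Finite V] (G : SimpleGraph V) : Polynomial ℝ :=
  ∑ i ∈ Finset.range (Nat.card V + 1), (numIndepPartitions G i : ℝ) • X ^ i


/-- `b` is an independent set. -/
def IndS {V : Type*} (G : SimpleGraph V) (b : Finset V) : Prop :=
  ∀ u ∈ b, ∀ v ∈ b, u ≠ v → ¬ G.Adj u v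

/-- families of pairwise disjoint nontrivial independent sets of total rank `k`. -/
def Fam {V : Type*} (G : SimpleGraph V) (k : ℕ) (B : Finset (Finset V)) : Prop :=
  (∀ b ∈ B, 2 ≤ b.card ∧ IndS G b) ∧ (∀ b ∈ B, ∀ c ∈ B, b ≠ c → Disjoint b c) ∧
    ∑ b ∈ B, (b.card - 1) = k

section bij
open Classical
variable {V : Type*} [Fintype V]

noncomputable def fib (P : Setoid V) (q : Quotient P) : Finset V :=
  Finset.univ.filter fun v => (Quotient.mk P v) = q

noncomputable def blocks (P : Setoid V) : Finset (Finset V) :=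
  (Finset.univ.image (fib P)).filter fun b => 2 ≤ b.card

lemma mem_fib (P : Setoid V) (u v : V) : u ∈ fib P (Quotient.mk P v) ↔ P u v := by
  simp only [fib, Finset.mem_filter, Finset.mem_univ, true_and]
  exact Quotient.eq

lemma mem_blocks (P : Setoid V) (b : Finset V) :
    b ∈ blocks P ↔ 2 ≤ b.card ∧ ∃ v, b = fib P (Quotient.mk P v) := by
  simp only [blocks, Finset.mem_filter, Finset.mem_image, Finset.mem_univ, true_and]
  constructor
  · rintro ⟨⟨q, rfl⟩, h⟩
    obtain ⟨v, rfl⟩ := Quotient.exists_rep q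
    exact ⟨h, v, rfl⟩
  · rintro ⟨h, v, rfl⟩
    exact ⟨⟨_, rfl⟩, h⟩

lemma fib_inj (P : Setoid V) : Function.Injective (fib P) := by
  intro q r h
  obtain ⟨v, rfl⟩ := Quotient.exists_rep q
  have : v ∈ fib P r := by rw [← h, mem_fib]
  simpa [fib] using this

lemma blocks_rank (P : Setoid V) :
    Nat.card (Quotient P) + ∑ b ∈ blocks P, (b.card - 1) = Nat.card V := by
  have h1 : Fintype.card V = ∑ q : Quotient P, (fib P q).card := by
    have := Finset.card_eq_sum_card_fiberwise (f := fun v : V => Quotient.mk P v)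
      (s := Finset.univ) (t := Finset.univ) (by intro x _; simp)
    simpa [fib] using this
  have h2 : ∑ b ∈ blocks P, (b.card - 1) = ∑ q : Quotient P, ((fib P q).card - 1) := by
    rw [blocks, Finset.sum_filter_of_ne, Finset.sum_image]
    · intro a _ b _ h
      exact fib_inj P h
    · intro b _ h
      omega
  have h3 : ∀ q : Quotient P, 1 ≤ (fib P q).card := by
    intro q
    obtain ⟨v, rfl⟩ := Quotient.exists_rep q
    exact Finset.card_pos.2 ⟨v, by rw [mem_fib]⟩
  rw [h2, Nat.card_eq_fintype_card, Nat.card_eq_fintype_card, h1]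
  have : Fintype.card (Quotient P) = ∑ q : Quotient P, 1 := by simp
  rw [this, ← Finset.sum_add_distrib]
  exact Finset.sum_congr rfl fun q _ => by have := h3 q; omega

lemma blocks_rel (P : Setoid V) (u v : V) :
    P u v ↔ u = v ∨ ∃ b ∈ blocks P, u ∈ b ∧ v ∈ b := by
  constructor
  · intro h
    by_cases huv : u = v
    · exact Or.inl huv
    · refine Or.inr ⟨fib P (Quotient.mk P v), ?_, ?_, ?_⟩
      · rw [mem_blocks]
        refine ⟨?_, v, rfl⟩
        have : ({u, v} : Finset V) ⊆ fib P (Quotient.mk P v) := by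
          intro w hw
          rw [mem_fib]
          simp only [Finset.mem_insert, Finset.mem_singleton] at hw
          rcases hw with rfl | rfl
          · exact h
          · exact P.refl _
        have h2 := Finset.card_le_card this
        rwa [Finset.card_pair huv] at h2
      · rwa [mem_fib]
      · rw [mem_fib]
  · rintro (rfl | ⟨b, hb, hu, hv⟩)
    · exact P.refl _
    · rw [mem_blocks] at hb
      obtain ⟨_, w, rfl⟩ := hb
      rw [mem_fib] at hu hv
      exact P.trans hu (P.symm hv)

lemma indep_iff (G : SimpleGraph V) (P : Setoid V) :
    (∀ c ∈ P.classes, c.Pairwise fun u v => ¬ G.Adj u v) ↔ ∀ u v, P u v → ¬ G.Adj u v := by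
  constructor
  · intro h u v huv hadj
    exact h {x | P x v} (P.mem_classes v) huv (P.refl v) hadj.ne hadj
  · rintro h c ⟨w, rfl⟩ u hu v hv _
    exact h u v (P.trans hu (P.symm hv))

lemma blocks_fam (G : SimpleGraph V) (P : Setoid V) (hP : ∀ u v, P u v → ¬ G.Adj u v) {k : ℕ}
    (hk : Nat.card (Quotient P) + k = Nat.card V) : Fam G k (blocks P) := by
  refine ⟨?_, ?_, ?_⟩
  · intro b hb
    refine ⟨((mem_blocks P b).1 hb).1, fun u hu v hv _ => hP u v ?_⟩
    exact (blocks_rel P u v).2 (Or.inr ⟨b, hb, hu, hv⟩)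
  · intro b hb c hc hbc
    rw [mem_blocks] at hb hc
    obtain ⟨_, v, rfl⟩ := hb
    obtain ⟨_, w, rfl⟩ := hc
    rw [Finset.disjoint_left]
    intro u hu hu'
    apply hbc
    simp only [fib, Finset.mem_filter, Finset.mem_univ, true_and] at hu hu'
    rw [← hu, ← hu']
  · have := blocks_rank P
    omega

lemma exists_setoid (B : Finset (Finset V)) (h2 : ∀ b ∈ B, 2 ≤ b.card)
    (hd : ∀ b ∈ B, ∀ c ∈ B, b ≠ c → Disjoint b c) : ∃ P : Setoid V, blocks P = B := by
  let P : Setoid V :=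
    { r := fun u v => u = v ∨ ∃ b ∈ B, u ∈ b ∧ v ∈ b
      iseqv := by
        refine ⟨fun _ => Or.inl rfl, ?_, ?_⟩
        · rintro u v (h | ⟨b, hb, hu, hv⟩)
          · exact Or.inl h.symm
          · exact Or.inr ⟨b, hb, hv, hu⟩
        · rintro u v w (rfl | ⟨b, hb, hu, hv⟩) (rfl | ⟨c, hc, hv', hw⟩)
          · exact Or.inl rfl
          · exact Or.inr ⟨c, hc, hv', hw⟩
          · exact Or.inr ⟨b, hb, hu, hv⟩
          · by_cases hbc : b = c
            · subst hbc
              exact Or.inr ⟨b, hb, hu, hw⟩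
            · exact absurd hv' (Finset.disjoint_left.1 (hd b hb c hc hbc) hv) }
  have hP : ∀ u v, P u v ↔ (u = v ∨ ∃ b ∈ B, u ∈ b ∧ v ∈ b) := fun _ _ => Iff.rfl
  have key : ∀ b ∈ B, ∀ v ∈ b, fib P (Quotient.mk P v) = b := by
    intro b hb v hv
    ext u
    rw [mem_fib, hP]
    constructor
    · rintro (rfl | ⟨c, hc, hu, hv'⟩)
      · exact hv
      · by_cases hbc : b = c
        · rwa [hbc]
        · exact absurd hv' (Finset.disjoint_left.1 (hd b hb c hc hbc) hv)
    · intro hu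
      exact Or.inr ⟨b, hb, hu, hv⟩
  refine ⟨P, ?_⟩
  ext b
  rw [mem_blocks]
  constructor
  · rintro ⟨hb, v, rfl⟩
    obtain ⟨u, hu, huv⟩ := Finset.exists_mem_ne (s := fib P (Quotient.mk P v)) (by omega) v
    rw [mem_fib, hP] at hu
    rcases hu with h | ⟨c, hc, hu, hv⟩
    · exact absurd h huv
    · rw [key c hc v hv]; exact hc
  · intro hb
    refine ⟨h2 b hb, ?_⟩
    obtain ⟨v, hv⟩ := Finset.card_pos.1 (by have := h2 b hb; omega : 0 < b.card)
    exact ⟨v, (key b hb v hv).symm⟩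

lemma fam_setoid (G : SimpleGraph V) {k : ℕ} {B : Finset (Finset V)} (hB : Fam G k B) :
    ∃ P : Setoid V, blocks P = B ∧ (∀ u v, P u v → ¬ G.Adj u v) ∧
      Nat.card (Quotient P) + k = Nat.card V := by
  obtain ⟨P, hP⟩ := exists_setoid B (fun b hb => (hB.1 b hb).1) hB.2.1
  refine ⟨P, hP, ?_, ?_⟩
  · intro u v huv
    rw [blocks_rel, hP] at huv
    rcases huv with rfl | ⟨b, hb, hu, hv⟩
    · exact G.loopless.irrefl _
    · intro hadj
      exact (hB.1 b hb).2 u hu v hv hadj.ne hadj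
  · have := blocks_rank P
    rw [hP, hB.2.2] at this
    exact this

lemma num_eq (G : SimpleGraph V) {i k : ℕ} (hik : i + k = Nat.card V) :
    numIndepPartitions G i = Nat.card {B // Fam G k B} := by
  unfold numIndepPartitions
  refine Nat.card_congr (Equiv.ofBijective (fun P => ⟨blocks P.1, ?_⟩) ⟨?_, ?_⟩)
  · exact blocks_fam G P.1 ((indep_iff G P.1).1 P.2.2) (by rw [P.2.1]; exact hik)
  · rintro ⟨P, hP⟩ ⟨Q, hQ⟩ h
    have h' : blocks P = blocks Q := congrArg Subtype.val h
    apply Subtype.ext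
    ext u v
    change P u v ↔ Q u v
    rw [blocks_rel, blocks_rel, h']
  · rintro ⟨B, hB⟩
    obtain ⟨P, h1, h2, h3⟩ := fam_setoid G hB
    exact ⟨⟨P, by omega, (indep_iff G P).2 h2⟩, Subtype.ext h1⟩

lemma colorable_of (G : SimpleGraph V) (P : Setoid V) (hP : ∀ u v, P u v → ¬ G.Adj u v) :
    G.Colorable (Nat.card (Quotient P)) := by
  have C : G.Coloring (Quotient P) := SimpleGraph.Coloring.mk (Quotient.mk P) (by
    intro u v huv h
    exact hP u v (Quotient.exact h) huv)
  rw [Nat.card_eq_fintype_card]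
  exact C.colorable

lemma num_gt (G : SimpleGraph V) {i : ℕ} (hi : Nat.card V < i) : numIndepPartitions G i = 0 := by
  unfold numIndepPartitions
  have : IsEmpty {P : Setoid V // Nat.card (Quotient P) = i ∧
    ∀ c ∈ P.classes, c.Pairwise fun u v => ¬ G.Adj u v} := by
    constructor
    rintro ⟨P, h, _⟩
    have := blocks_rank P
    omega
  exact Nat.card_of_isEmpty

lemma num_lt (G : SimpleGraph V) (h : ((Nat.card V - 3 : ℕ) : ℕ∞) ≤ G.chromaticNumber)
    {i : ℕ} (hi : i + 4 ≤ Nat.card V) : numIndepPartitions G i = 0 := by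
  unfold numIndepPartitions
  have : IsEmpty {P : Setoid V // Nat.card (Quotient P) = i ∧
    ∀ c ∈ P.classes, c.Pairwise fun u v => ¬ G.Adj u v} := by
    constructor
    rintro ⟨P, h1, h2⟩
    have h3 := (colorable_of G P ((indep_iff G P).1 h2)).chromaticNumber_le
    have h4 := h.trans h3
    rw [h1] at h4
    have : Nat.card V - 3 ≤ i := by exact_mod_cast h4
    omega
  exact Nat.card_of_isEmpty

lemma no_fam4 (G : SimpleGraph V) (h : ((Nat.card V - 3 : ℕ) : ℕ∞) ≤ G.chromaticNumber)
    (B : Finset (Finset V)) : ¬ Fam G 4 B := by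
  intro hB
  obtain ⟨P, _, h2, h3⟩ := fam_setoid G hB
  have h4 := h.trans (colorable_of G P h2).chromaticNumber_le
  have : Nat.card V - 3 ≤ Nat.card (Quotient P) := by exact_mod_cast h4
  omega

end bij

section fam
open Classical
variable {V : Type*} {G : SimpleGraph V}

lemma IndS.mono {b c : Finset V} (h : IndS G c) (hbc : b ⊆ c) : IndS G b :=
  fun u hu v hv => h u (hbc hu) v (hbc hv)

lemma fam_insert {k : ℕ} {C : Finset (Finset V)} {b : Finset V} (hC : Fam G k C)
    (h2 : 2 ≤ b.card) (hi : IndS G b) (hd : ∀ c ∈ C, Disjoint b c) :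
    Fam G (b.card - 1 + k) (insert b C) := by
  have hb : b ∉ C := by
    intro h
    have := hd b h
    rw [disjoint_self] at this
    subst this
    simp at h2
  refine ⟨?_, ?_, ?_⟩
  · intro c hc
    rcases Finset.mem_insert.1 hc with rfl | hc
    · exact ⟨h2, hi⟩
    · exact hC.1 c hc
  · intro c hc d hd' hcd
    rcases Finset.mem_insert.1 hc with h1 | h1 <;> rcases Finset.mem_insert.1 hd' with h3 | h3
    · exact absurd (h1.trans h3.symm) hcd
    · rw [h1]; exact hd _ h3
    · rw [h3]; exact (hd _ h1).symm
    · exact hC.2.1 c h1 d h3 hcd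
  · rw [Finset.sum_insert hb, hC.2.2]

lemma fam_empty : Fam G 0 (∅ : Finset (Finset V)) := by
  refine ⟨?_, ?_, ?_⟩ <;> simp

lemma fam_one {b : Finset V} (h2 : 2 ≤ b.card) (hi : IndS G b) : Fam G (b.card - 1) {b} := by
  have := fam_insert fam_empty h2 hi (by simp)
  simpa using this

lemma fam_two {b c : Finset V} (h2 : 2 ≤ b.card) (hi : IndS G b) (h2' : 2 ≤ c.card)
    (hi' : IndS G c) (hd : Disjoint b c) : Fam G (b.card - 1 + (c.card - 1)) {b, c} :=
  fam_insert (fam_one h2' hi') h2 hi (by simpa using hd)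

lemma fam_zero {B : Finset (Finset V)} (h : Fam G 0 B) : B = ∅ := by
  rw [Finset.eq_empty_iff_forall_notMem]
  intro b hb
  have h1 := (Finset.sum_eq_zero_iff.1 h.2.2) b hb
  have := (h.1 b hb).1
  omega

lemma fam_peel {k : ℕ} {B : Finset (Finset V)} (h : Fam G (k + 1) B) :
    ∃ b C j, B = insert b C ∧ 2 ≤ b.card ∧ IndS G b ∧ (∀ c ∈ C, Disjoint b c) ∧ Fam G j C ∧
      (b.card - 1) + j = k + 1 := by
  have hne : B.Nonempty := by
    rw [Finset.nonempty_iff_ne_empty]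
    rintro rfl
    have := h.2.2
    simp at this
  obtain ⟨b, hb⟩ := hne
  refine ⟨b, B.erase b, ∑ c ∈ B.erase b, (c.card - 1), (Finset.insert_erase hb).symm,
    (h.1 b hb).1, (h.1 b hb).2, ?_, ⟨?_, ?_, rfl⟩, ?_⟩
  · intro c hc
    rw [Finset.mem_erase] at hc
    exact h.2.1 b hb c hc.2 hc.1.symm
  · intro c hc
    exact h.1 c (Finset.mem_of_mem_erase hc)
  · intro c hc d hd
    exact h.2.1 c (Finset.mem_of_mem_erase hc) d (Finset.mem_of_mem_erase hd)
  · rw [Finset.add_sum_erase B (fun c => c.card - 1) hb]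
    exact h.2.2

lemma fam_class1 {B : Finset (Finset V)} (h : Fam G 1 B) :
    ∃ e, B = {e} ∧ e.card = 2 ∧ IndS G e := by
  obtain ⟨b, C, j, rfl, h2, hi, hd, hC, hj⟩ := fam_peel h
  obtain rfl : j = 0 := by omega
  rw [fam_zero hC]
  exact ⟨b, by simp, by omega, hi⟩

lemma fam_class2 {B : Finset (Finset V)} (h : Fam G 2 B) :
    (∃ T, B = {T} ∧ T.card = 3 ∧ IndS G T) ∨
    (∃ e f, B = {e, f} ∧ e.card = 2 ∧ f.card = 2 ∧ IndS G e ∧ IndS G f ∧ Disjoint e f) := by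
  obtain ⟨b, C, j, rfl, h2, hi, hd, hC, hj⟩ := fam_peel h
  have : j = 0 ∨ j = 1 := by omega
  rcases this with rfl | rfl
  · rw [fam_zero hC]
    exact Or.inl ⟨b, by simp, by omega, hi⟩
  · obtain ⟨e, rfl, he, hie⟩ := fam_class1 hC
    exact Or.inr ⟨b, e, rfl, by omega, he, hi, hie, hd e (by simp)⟩

lemma fam_class3 {B : Finset (Finset V)} (h : Fam G 3 B) :
    (∃ K, B = {K} ∧ K.card = 4 ∧ IndS G K) ∨
    (∃ T g, B = {T, g} ∧ T.card = 3 ∧ g.card = 2 ∧ IndS G T ∧ IndS G g ∧ Disjoint T g) ∨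
    (∃ a b c, B = {a, b, c} ∧ a.card = 2 ∧ b.card = 2 ∧ c.card = 2 ∧ IndS G a ∧ IndS G b ∧
      IndS G c ∧ Disjoint a b ∧ Disjoint a c ∧ Disjoint b c) := by
  obtain ⟨b, C, j, rfl, h2, hi, hd, hC, hj⟩ := fam_peel h
  have : j = 0 ∨ j = 1 ∨ j = 2 := by omega
  rcases this with rfl | rfl | rfl
  · rw [fam_zero hC]
    exact Or.inl ⟨b, by simp, by omega, hi⟩
  · obtain ⟨e, rfl, he, hie⟩ := fam_class1 hC
    exact Or.inr (Or.inl ⟨b, e, rfl, by omega, he, hi, hie, hd e (by simp)⟩)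
  · rcases fam_class2 hC with ⟨T, rfl, hT, hiT⟩ | ⟨e, f, rfl, he, hf, hie, hif, hef⟩
    · exact Or.inr (Or.inl ⟨T, b, by rw [Finset.pair_comm], hT, by omega, hiT, hi,
        (hd T (by simp)).symm⟩)
    · exact Or.inr (Or.inr ⟨b, e, f, rfl, by omega, he, hf, hi, hie, hif, hd e (by simp),
        hd f (by simp), hef⟩)

/-- The matching relation behind `W₁ W₃ ≤ W₂²`. -/
def PRel (G : SimpleGraph V) (e : Finset V) (z x y : Finset (Finset V)) : Prop :=
  (x.card = 2 ∧ ∃ f, y = {e, f} ∧ Disjoint e f ∧ (∀ a ∈ x, Disjoint f a) ∧ z = insert f x) ∨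
  (∃ T g, x = {T} ∧ y = {e, g} ∧ Disjoint e g ∧ Disjoint g T ∧ z = {T, g}) ∨
  (∃ T f, y = {T} ∧ x = {f, e} ∧ Disjoint f e ∧ f ⊆ T ∧ Disjoint e T ∧ z = {T, e}) ∨
  (∃ f g f', x = {e, f} ∧ y = {g, f'} ∧ Disjoint e f ∧ Disjoint g f' ∧ Disjoint f g ∧
    (f ∪ f').card = 3 ∧ IndS G (f ∪ f') ∧ ¬ Disjoint e g ∧ ¬ Disjoint f f' ∧ z = {f ∪ f', g}) ∨
  (∃ S T, x = {S} ∧ y = {T} ∧ e = S ∩ T ∧ z = {S ∪ T}) ∨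
  (∃ T f, x = {T} ∧ y = {e, f} ∧ Disjoint e f ∧ ¬ Disjoint f T ∧ ¬ Disjoint e T ∧
    ¬ IndS G (T ∪ e) ∧ IndS G (T ∪ f) ∧ z = {T ∪ f})

lemma pair_eq {α : Type*} [DecidableEq α] {a b c d : α} (h : ({a, b} : Finset α) = {c, d}) :
    (a = c ∧ b = d) ∨ (a = d ∧ b = c) := by
  have h1 : a ∈ ({c, d} : Finset α) := by rw [← h]; simp
  have h2 : b ∈ ({c, d} : Finset α) := by rw [← h]; simp
  have h3 : c ∈ ({a, b} : Finset α) := by rw [h]; simp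
  have h4 : d ∈ ({a, b} : Finset α) := by rw [h]; simp
  simp only [Finset.mem_insert, Finset.mem_singleton] at h1 h2 h3 h4
  grind

lemma pair_ne_single {e f T : Finset V} (he : 2 ≤ e.card) (hd : Disjoint e f)
    (h : ({e, f} : Finset (Finset V)) = {T}) : False := by
  have h1 : e ∈ ({T} : Finset (Finset V)) := by rw [← h]; simp
  have h2 : f ∈ ({T} : Finset (Finset V)) := by rw [← h]; simp
  rw [Finset.mem_singleton] at h1 h2
  subst h1; subst h2
  rw [disjoint_self] at hd
  subst hd
  simp at he

lemma rel_unique (h4 : ∀ B, ¬ Fam G 4 B) {e e' : Finset V} {z z' x y : Finset (Finset V)}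
    (he : e.card = 2) (he' : e'.card = 2)
    (hx : Fam G 2 x) (hy : Fam G 2 y)
    (h : PRel G e z x y) (h' : PRel G e' z' x y) : e = e' ∧ z = z' := by
  have sx : ∀ T, x = {T} → T.card = 3 ∧ IndS G T := by
    rintro T rfl
    have := hx.2.2
    have h5 := hx.1 T (by simp)
    simp only [Finset.sum_singleton] at this
    exact ⟨by omega, h5.2⟩
  have sy : ∀ T, y = {T} → T.card = 3 ∧ IndS G T := by
    rintro T rfl
    have := hy.2.2
    have h5 := hy.1 T (by simp)
    simp only [Finset.sum_singleton] at this
    exact ⟨by omega, h5.2⟩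
  have px : ∀ a ∈ x, 2 ≤ a.card ∧ IndS G a := hx.1
  have py : ∀ a ∈ y, 2 ≤ a.card ∧ IndS G a := hy.1
  have hx1 : ∀ f g, x = {f, g} → Disjoint f g → x.card = 2 := by
    rintro f g rfl hd
    apply Finset.card_pair
    rintro rfl
    have := (px f (by simp)).1
    rw [disjoint_self] at hd
    subst hd
    simp at this
  have hy1 : ∀ f g, y = {f, g} → Disjoint f g → y.card = 2 ∧ f.card = 2 ∧ g.card = 2 := by
    rintro f g rfl hd
    have hf := (py f (by simp)).1
    have hg := (py g (by simp)).1
    have hfg : f ≠ g := by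
      rintro rfl
      rw [disjoint_self] at hd
      subst hd
      simp at hf
    have := hy.2.2
    rw [Finset.sum_pair hfg] at this
    exact ⟨Finset.card_pair hfg, by omega, by omega⟩
  have hx0 : ∀ T, x = {T} → x.card = 1 := by rintro T rfl; simp
  have hy0 : ∀ T, y = {T} → y.card = 1 := by rintro T rfl; simp
  have dz : ∀ a b : Finset V, Disjoint a b → a ⊆ b → a.card = 0 := by
    intro a b h1 h2
    rw [Finset.card_eq_zero, Finset.eq_empty_iff_forall_notMem]
    intro u hu
    exact Finset.disjoint_left.1 h1 hu (h2 hu)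
  rcases h with ⟨hxc, f, hyf, hef, hfx, hz⟩ | ⟨T, g, hxT, hyg, heg, hgT, hz⟩ |
    ⟨T, f, hyT, hxf, hfe, hfT, heT, hz⟩ |
    ⟨f, g, f₁, hxf, hyg, hef, hgf, hfg, hc, hI, heg, hff, hz⟩ | ⟨S, T, hxS, hyT, heS, hz⟩ |
    ⟨T, f, hxT, hyf, hef, hfT, heT, hnI, hI, hz⟩ <;>
  rcases h' with ⟨hxc', f', hyf', hef', hfx', hz'⟩ | ⟨T', g', hxT', hyg', heg', hgT', hz'⟩ |
    ⟨T', f', hyT', hxf', hfe', hfT', heT', hz'⟩ |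
    ⟨f', g', f₁', hxf', hyg', hef', hgf', hfg', hc', hI', heg', hff', hz'⟩ |
    ⟨S', T', hxS', hyT', heS', hz'⟩ |
    ⟨T', f', hxT', hyf', hef', hfT', heT', hnI', hI', hz'⟩ <;>
  try (exfalso; grind)
  · rcases pair_eq (hyf.symm.trans hyf') with ⟨rfl, rfl⟩ | ⟨rfl, rfl⟩
    · exact ⟨rfl, hz.trans hz'.symm⟩
    · exfalso
      have := hy1 _ _ hyf hef
      have k1 := fam_insert hx (b := f) (by omega) (py _ (by simp [hyf])).2 hfx
      have k2 := fam_insert k1 (b := e) (by omega) (py _ (by simp [hyf])).2 (by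
        intro c hc
        rcases Finset.mem_insert.1 hc with rfl | hc
        · exact hef
        · exact hfx' c hc)
      rw [this.2.1, this.2.2] at k2
      exact h4 _ k2
  · exfalso
    rcases pair_eq (hyf.symm.trans hyg') with ⟨_, h1⟩ | ⟨_, h1⟩
    · exact hff' (h1 ▸ (hfx f' (by simp [hxf'])).symm)
    · exact heg' (h1 ▸ (hfx e' (by simp [hxf'])).symm)
  · have hT : T = T' := Finset.singleton_inj.1 (hxT.symm.trans hxT')
    subst hT
    rcases pair_eq (hyg.symm.trans hyg') with ⟨rfl, rfl⟩ | ⟨rfl, rfl⟩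
    · exact ⟨rfl, hz.trans hz'.symm⟩
    · exfalso
      have hT := sx T hxT
      have k2 := fam_insert hy (b := T) (by omega) hT.2 (by
        intro c hc
        rw [hyg] at hc
        simp only [Finset.mem_insert, Finset.mem_singleton] at hc
        rcases hc with rfl | rfl
        · exact hgT'.symm
        · exact hgT.symm)
      rw [hT.1] at k2
      exact h4 _ k2
  · have hT : T = T' := Finset.singleton_inj.1 (hyT.symm.trans hyT')
    subst hT
    rcases pair_eq (hxf.symm.trans hxf') with ⟨rfl, rfl⟩ | ⟨rfl, rfl⟩
    · exact ⟨rfl, hz.trans hz'.symm⟩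
    · exfalso
      have := dz _ _ heT hfT'
      omega
  · exfalso
    rcases pair_eq (hyf'.symm.trans hyg) with ⟨_, h1⟩ | ⟨_, h1⟩
    · exact hff (h1 ▸ (hfx' f (by simp [hxf])).symm)
    · exact heg (h1 ▸ (hfx' e (by simp [hxf])).symm)
  · rcases pair_eq (hxf.symm.trans hxf') with ⟨rfl, rfl⟩ | ⟨rfl, rfl⟩ <;>
    rcases pair_eq (hyg.symm.trans hyg') with ⟨rfl, rfl⟩ | ⟨rfl, rfl⟩
    · exact ⟨rfl, hz.trans hz'.symm⟩
    · exact absurd hfg' hff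
    · exact absurd hfg heg'
    · exfalso
      have hd : Disjoint (f ∪ f₁) (e ∪ g) := by
        rw [Finset.disjoint_union_left, Finset.disjoint_union_right, Finset.disjoint_union_right]
        exact ⟨⟨hef.symm, hfg⟩, ⟨hfg'.symm, hgf.symm⟩⟩
      have k := fam_two (by omega) hI (by omega) hI' hd
      rw [hc, hc'] at k
      exact h4 _ k
  · have hT : T = T' := Finset.singleton_inj.1 (hyT.symm.trans hyT')
    have hS : S = S' := Finset.singleton_inj.1 (hxS.symm.trans hxS')
    subst hT hS
    exact ⟨heS.trans heS'.symm, hz.trans hz'.symm⟩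
  · have hT : T = T' := Finset.singleton_inj.1 (hxT.symm.trans hxT')
    subst hT
    rcases pair_eq (hyf.symm.trans hyf') with ⟨rfl, rfl⟩ | ⟨rfl, rfl⟩
    · exact ⟨rfl, hz.trans hz'.symm⟩
    · exact absurd hI hnI'

lemma rel_exists (h4 : ∀ B, ¬ Fam G 4 B) {e : Finset V} {z : Finset (Finset V)}
    (he : e.card = 2) (hie : IndS G e) (hz : Fam G 3 z) :
    ∃ x y, Fam G 2 x ∧ Fam G 2 y ∧ PRel G e z x y := by
  have f1 : ∀ T : Finset V, T.card = 3 → IndS G T → Fam G 2 {T} := by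
    intro T hT hi
    have := fam_one (by omega) hi
    rwa [hT] at this
  have f2 : ∀ a b : Finset V, a.card = 2 → b.card = 2 → IndS G a → IndS G b → Disjoint a b →
      Fam G 2 {a, b} := by
    intro a b ha hb hia hib hd
    have := fam_two (by omega) hia (by omega) hib hd
    rwa [ha, hb] at this
  rcases fam_class3 hz with ⟨K, rfl, hK, hiK⟩ | ⟨T, g, rfl, hT, hg, hiT, hig, hd⟩ |
    ⟨a, b, c, rfl, ha, hb, hc, hia, hib, hic, hab, hac, hbc⟩
  · by_cases heK : e ⊆ K
    · have hcard : (K \ e).card = 2 := by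
        rw [Finset.card_sdiff_of_subset heK]; omega
      obtain ⟨c, d, hcd, hKe⟩ := Finset.card_eq_two.1 hcard
      have hc : c ∈ K ∧ c ∉ e := by rw [← Finset.mem_sdiff, hKe]; simp
      have hd : d ∈ K ∧ d ∉ e := by rw [← Finset.mem_sdiff, hKe]; simp
      have hKu : ∀ v, v ∈ K ↔ v ∈ e ∨ v = c ∨ v = d := by
        intro v
        have : v ∈ K \ e ↔ v = c ∨ v = d := by rw [hKe]; simp
        rw [Finset.mem_sdiff] at this
        have := @heK v
        tauto
      refine ⟨{insert c e}, {insert d e}, f1 _ ?_ ?_, f1 _ ?_ ?_, ?_⟩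
      · rw [Finset.card_insert_of_notMem hc.2, he]
      · exact hiK.mono (Finset.insert_subset hc.1 heK)
      · rw [Finset.card_insert_of_notMem hd.2, he]
      · exact hiK.mono (Finset.insert_subset hd.1 heK)
      · refine Or.inr (Or.inr (Or.inr (Or.inr (Or.inl ⟨_, _, rfl, rfl, ?_, ?_⟩))))
        · ext v; simp only [Finset.mem_inter, Finset.mem_insert]; grind
        · congr 1; ext v; simp only [Finset.mem_union, Finset.mem_insert, hKu]; tauto
    · have hnd : ¬ Disjoint e K := by
        intro hd
        have := fam_two (by omega) hie (by omega) hiK hd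
        rw [he, hK] at this
        exact h4 _ this
      obtain ⟨a, hae, haK⟩ := Finset.not_disjoint_iff.1 hnd
      obtain ⟨v, hve, hvK⟩ := Finset.not_subset.1 heK
      have hav : a ≠ v := by rintro rfl; exact hvK haK
      have heq : e = {a, v} := by
        symm
        apply Finset.eq_of_subset_of_card_le
        · intro w hw
          simp only [Finset.mem_insert, Finset.mem_singleton] at hw
          rcases hw with rfl | rfl <;> assumption
        · rw [Finset.card_pair hav, he]
      obtain ⟨c, hcK, hcv⟩ : ∃ c ∈ K, G.Adj c v := by
        by_contra hcon
        push Not at hcon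
        have hI : IndS G (insert v K) := by
          intro p hp q hq hpq
          rcases Finset.mem_insert.1 hp with h1 | h1 <;>
          rcases Finset.mem_insert.1 hq with h3 | h3
          · exact absurd (h1.trans h3.symm) hpq
          · intro h; rw [h1] at h; exact hcon q h3 h.symm
          · rw [h3]; exact hcon p h1
          · exact hiK p h1 q h3 hpq
        have hc5 : (insert v K).card = 5 := by rw [Finset.card_insert_of_notMem hvK, hK]
        have := fam_one (by omega) hI
        rw [hc5] at this
        exact h4 _ this
      have hca : c ≠ a := by
        rintro rfl
        exact hie c hae v hve hav hcv
      have hcard : (K \ {a, c}).card = 2 := by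
        rw [Finset.card_sdiff_of_subset, Finset.card_pair hca.symm, hK]
        intro w hw
        simp only [Finset.mem_insert, Finset.mem_singleton] at hw
        rcases hw with rfl | rfl <;> assumption
      obtain ⟨b, d, hbd, hKe⟩ := Finset.card_eq_two.1 hcard
      have hb : b ∈ K \ {a, c} := by rw [hKe]; simp
      have hd : d ∈ K \ {a, c} := by rw [hKe]; simp
      simp only [Finset.mem_sdiff, Finset.mem_insert, Finset.mem_singleton, not_or] at hb hd
      have hKu : ∀ v, v ∈ K ↔ v = a ∨ v = b ∨ v = c ∨ v = d := by
        intro v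
        have : v ∈ K \ {a, c} ↔ v = b ∨ v = d := by rw [hKe]; simp
        simp only [Finset.mem_sdiff, Finset.mem_insert, Finset.mem_singleton, not_or] at this
        by_cases h1 : v = a
        · subst h1; tauto
        · by_cases h2 : v = c
          · subst h2; tauto
          · tauto
      have hTK : ({a, b, c} : Finset V) ⊆ K := by
        intro w hw
        simp only [Finset.mem_insert, Finset.mem_singleton] at hw
        rw [hKu]; tauto
      have hfK : ({b, d} : Finset V) ⊆ K := by
        intro w hw
        simp only [Finset.mem_insert, Finset.mem_singleton] at hw
        rw [hKu]; tauto
      have hdis : Disjoint e {b, d} := by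
        rw [heq]
        simp only [Finset.disjoint_insert_left, Finset.disjoint_singleton_left,
          Finset.mem_insert, Finset.mem_singleton, not_or]
        refine ⟨⟨Ne.symm hb.2.1, Ne.symm hd.2.1⟩, ?_, ?_⟩
        · rintro rfl; exact hvK hb.1
        · rintro rfl; exact hvK hd.1
      have hun : ({a, b, c} : Finset V) ∪ {b, d} = K := by
        ext w
        simp only [Finset.mem_union, Finset.mem_insert, Finset.mem_singleton, hKu]
        tauto
      refine ⟨{{a, b, c}}, {e, {b, d}}, f1 _ ?_ (hiK.mono hTK),
        f2 _ _ he (Finset.card_pair hbd) hie (hiK.mono hfK) hdis, ?_⟩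
      · exact Finset.card_eq_three.2 ⟨a, b, c, Ne.symm hb.2.1, Ne.symm hca, hb.2.2, rfl⟩
      · refine Or.inr (Or.inr (Or.inr (Or.inr (Or.inr
          ⟨_, _, rfl, rfl, hdis, ?_, ?_, ?_, ?_, ?_⟩))))
        · exact Finset.not_disjoint_iff.2 ⟨b, by simp, by simp⟩
        · exact Finset.not_disjoint_iff.2 ⟨a, hae, by simp⟩
        · intro hI
          exact hI c (by simp) v (by simp [hve]) (by rintro rfl; exact hvK hcK) hcv
        · rw [hun]; exact hiK
        · rw [hun]
  · by_cases heg : Disjoint e g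
    · exact ⟨{T}, {e, g}, f1 T hT hiT, f2 e g he hg hie hig heg,
        Or.inr (Or.inl ⟨T, g, rfl, rfl, heg, hd.symm, rfl⟩)⟩
    · by_cases hEq : e = g
      · subst hEq
        obtain ⟨f, hfT, hf⟩ := Finset.exists_subset_card_eq (by omega : 2 ≤ T.card)
        have hfe : Disjoint f e := Finset.disjoint_of_subset_left hfT hd
        exact ⟨{f, e}, {T}, f2 f e hf he (hiT.mono hfT) hie hfe, f1 T hT hiT,
          Or.inr (Or.inr (Or.inl ⟨T, f, rfl, rfl, hfe, hfT, hd.symm, rfl⟩))⟩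
      · obtain ⟨v, hve, hvg⟩ := Finset.not_disjoint_iff.1 heg
        have hvT : v ∉ T := fun h => Finset.disjoint_left.1 hd h hvg
        obtain ⟨w, hwe, hwv⟩ := Finset.exists_mem_ne (by omega : 1 < e.card) v
        have heq : e = {v, w} := by
          symm
          apply Finset.eq_of_subset_of_card_le
          · intro u hu
            simp only [Finset.mem_insert, Finset.mem_singleton] at hu
            rcases hu with rfl | rfl <;> assumption
          · rw [Finset.card_pair hwv.symm, he]
        have hTw : 2 ≤ (T.erase w).card := by
          have := Finset.pred_card_le_card_erase (s := T) (a := w)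
          omega
        obtain ⟨f, hfTw, hf⟩ := Finset.exists_subset_card_eq hTw
        have hfT : f ⊆ T := hfTw.trans (Finset.erase_subset _ _)
        have hwf : w ∉ f := fun h => Finset.notMem_erase w T (hfTw h)
        have hvf : v ∉ f := fun h => hvT (hfT h)
        obtain ⟨r, s, hrs, rfl⟩ := Finset.card_eq_two.1 hf
        have hc1 : (T \ {r, s}).card = 1 := by
          rw [Finset.card_sdiff_of_subset hfT]; omega
        obtain ⟨t, ht⟩ := Finset.card_eq_one.1 hc1
        have ht' : t ∈ T \ {r, s} := by rw [ht]; simp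
        rw [Finset.mem_sdiff] at ht'
        have hrt : r ≠ t := by rintro rfl; exact ht'.2 (by simp)
        have hf'T : ({r, t} : Finset V) ⊆ T := by
          intro u hu
          simp only [Finset.mem_insert, Finset.mem_singleton] at hu
          rcases hu with rfl | rfl
          · exact hfT (by simp)
          · exact ht'.1
        have hun : ({r, s} : Finset V) ∪ {r, t} = T := by
          apply Finset.eq_of_subset_of_card_le (Finset.union_subset hfT hf'T)
          rw [hT]
          have : insert t ({r, s} : Finset V) ⊆ {r, s} ∪ {r, t} := by
            intro u hu
            simp only [Finset.mem_insert, Finset.mem_singleton, Finset.mem_union] at hu ⊢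
            tauto
          have h5 := Finset.card_le_card this
          rwa [Finset.card_insert_of_notMem ht'.2, hf] at h5
        have hef : Disjoint e {r, s} := by
          rw [heq, Finset.disjoint_insert_left, Finset.disjoint_singleton_left]
          exact ⟨hvf, hwf⟩
        have hgf : Disjoint g {r, t} := (Finset.disjoint_of_subset_left hf'T hd).symm
        refine ⟨{e, {r, s}}, {g, {r, t}}, f2 _ _ he hf hie (hiT.mono hfT) hef,
          f2 _ _ hg (Finset.card_pair hrt) hig (hiT.mono hf'T) hgf,
          Or.inr (Or.inr (Or.inr (Or.inl ⟨_, _, _, rfl, rfl, hef, hgf,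
            Finset.disjoint_of_subset_left hfT hd, ?_, ?_, heg, ?_, ?_⟩)))⟩
        · rw [hun, hT]
        · rw [hun]; exact hiT
        · exact Finset.not_disjoint_iff.2 ⟨r, by simp, by simp⟩
        · rw [hun]
  · obtain ⟨v, w, hvw, heq⟩ := Finset.card_eq_two.1 he
    have key : ∀ a b c : Finset V, a.card = 2 → b.card = 2 → c.card = 2 → IndS G a → IndS G b →
        IndS G c → Disjoint a b → Disjoint a c → Disjoint b c → Disjoint e a →
        ∃ x y, Fam G 2 x ∧ Fam G 2 y ∧ PRel G e {a, b, c} x y := by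
      intro a b c ha hb hc hia hib hic hab hac hbc hea
      refine ⟨{b, c}, {e, a}, f2 _ _ hb hc hib hic hbc, f2 _ _ he ha hie hia hea,
        Or.inl ⟨?_, a, rfl, hea, ?_, rfl⟩⟩
      · apply Finset.card_pair
        rintro rfl
        rw [disjoint_self] at hbc
        subst hbc
        simp at hb
      · intro d hd
        simp only [Finset.mem_insert, Finset.mem_singleton] at hd
        rcases hd with rfl | rfl <;> assumption
    have hdj : Disjoint e a ∨ Disjoint e b ∨ Disjoint e c := by
      rw [Finset.disjoint_left] at hab hac hbc
      have h1 := @hab v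
      have h2 := @hac v
      have h3 := @hbc v
      have h1' := @hab w
      have h2' := @hac w
      have h3' := @hbc w
      simp only [heq, Finset.disjoint_insert_left, Finset.disjoint_singleton_left]
      clear key f2 f1 hz
      grind
    rcases hdj with h | h | h
    · exact key a b c ha hb hc hia hib hic hab hac hbc h
    · have := key b a c hb ha hc hib hia hic hab.symm hbc hac h
      rwa [Finset.insert_comm] at this
    · have := key c a b hc ha hb hic hia hib hac.symm hbc.symm hab h
      have h5 : ({c, a, b} : Finset (Finset V)) = {a, b, c} := by
        ext; simp only [Finset.mem_insert, Finset.mem_singleton]; tauto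
      rwa [h5] at this

lemma count13 [Fintype V] (h4 : ∀ B, ¬ Fam G 4 B) :
    Nat.card {B // Fam G 3 B} * Nat.card {B // Fam G 1 B} ≤ Nat.card {B // Fam G 2 B} ^ 2 := by
  rw [sq, ← Nat.card_prod, ← Nat.card_prod]
  have hex : ∀ p : {B // Fam G 3 B} × {B // Fam G 1 B},
      ∃ q : {B // Fam G 2 B} × {B // Fam G 2 B}, ∃ e, p.2.1 = {e} ∧ e.card = 2 ∧
        PRel G e p.1.1 q.1.1 q.2.1 := by
    rintro ⟨⟨z, hz⟩, ⟨B, hB⟩⟩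
    obtain ⟨e, rfl, he, hie⟩ := fam_class1 hB
    obtain ⟨x, y, hx, hy, hR⟩ := rel_exists h4 he hie hz
    exact ⟨⟨⟨x, hx⟩, ⟨y, hy⟩⟩, e, rfl, he, hR⟩
  choose φ hφ using hex
  refine Nat.card_le_card_of_injective φ ?_
  intro p q hpq
  obtain ⟨e, he, hec, hR⟩ := hφ p
  obtain ⟨e', he', hec', hR'⟩ := hφ q
  rw [← hpq] at hR'
  obtain ⟨h1, h2⟩ := rel_unique h4 hec hec' (φ p).1.2 (φ p).2.2 hR hR'
  apply Prod.ext
  · exact Subtype.ext h2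
  · apply Subtype.ext
    rw [he, he', h1]

lemma count02 [Fintype V] :
    Nat.card {B // Fam G 2 B} * Nat.card {B // Fam G 0 B} ≤ Nat.card {B // Fam G 1 B} ^ 2 := by
  have h0 : Nat.card {B // Fam G 0 B} ≤ 1 := by
    have : Subsingleton {B // Fam G 0 B} :=
      ⟨fun a b => Subtype.ext ((fam_zero a.2).trans (fam_zero b.2).symm)⟩
    exact Finite.card_le_one_iff_subsingleton.2 this
  refine (Nat.mul_le_mul_left _ h0).trans ?_
  rw [mul_one, sq, ← Nat.card_prod]
  have f1 : ∀ e : Finset V, e.card = 2 → IndS G e → Fam G 1 {e} := by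
    intro T hT hi
    have := fam_one (by omega) hi
    rwa [hT] at this
  have hex : ∀ p : {B // Fam G 2 B},
      ∃ q : {B // Fam G 1 B} × {B // Fam G 1 B}, ∃ e f, q.1.1 = {e} ∧ q.2.1 = {f} ∧
        ((Disjoint e f ∧ p.1 = {e, f}) ∨ (¬ Disjoint e f ∧ p.1 = {e ∪ f})) := by
    rintro ⟨B, hB⟩
    rcases fam_class2 hB with ⟨T, rfl, hT, hiT⟩ | ⟨e, f, rfl, he, hf, hie, hif, hd⟩
    · obtain ⟨a, b, c, hab, hac, hbc, rfl⟩ := Finset.card_eq_three.1 hT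
      refine ⟨⟨⟨{{a, b}}, f1 _ (Finset.card_pair hab) (hiT.mono ?_)⟩,
        ⟨{{a, c}}, f1 _ (Finset.card_pair hac) (hiT.mono ?_)⟩⟩, {a, b}, {a, c}, rfl, rfl,
        Or.inr ⟨?_, ?_⟩⟩
      · intro u hu
        simp only [Finset.mem_insert, Finset.mem_singleton] at hu ⊢
        tauto
      · intro u hu
        simp only [Finset.mem_insert, Finset.mem_singleton] at hu ⊢
        tauto
      · exact Finset.not_disjoint_iff.2 ⟨a, by simp, by simp⟩
      · rw [Finset.singleton_inj]
        ext u
        simp only [Finset.mem_insert, Finset.mem_singleton, Finset.mem_union]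
        tauto
    · exact ⟨⟨⟨{e}, f1 e he hie⟩, ⟨{f}, f1 f hf hif⟩⟩, e, f, rfl, rfl, Or.inl ⟨hd, rfl⟩⟩
  choose φ hφ using hex
  refine Nat.card_le_card_of_injective φ ?_
  intro p q hpq
  obtain ⟨e, f, he, hf, h⟩ := hφ p
  obtain ⟨e', f', he', hf', h'⟩ := hφ q
  rw [← hpq] at he' hf'
  have h1 : e = e' := Finset.singleton_inj.1 (he.symm.trans he')
  have h2 : f = f' := Finset.singleton_inj.1 (hf.symm.trans hf')
  subst h1 h2
  apply Subtype.ext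
  rcases h with ⟨h, hp⟩ | ⟨h, hp⟩ <;> rcases h' with ⟨h', hq⟩ | ⟨h', hq⟩
  · rw [hp, hq]
  · exact absurd h h'
  · exact absurd h' h
  · rw [hp, hq]

end fam

theorem numIndepPartitions_logConcave_of_chromaticNumber_ge_sub_three {V : Type*}
    [Finite V] (G : SimpleGraph V)
    (h : ((Nat.card V - 3 : ℕ) : ℕ∞) ≤ G.chromaticNumber) :
    ∀ i : ℕ, 1 ≤ i →
      numIndepPartitions G (i - 1) * numIndepPartitions G (i + 1) ≤
        numIndepPartitions G i ^ 2 := by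
  intro i hi
  have := Fintype.ofFinite V
  rcases Nat.lt_or_ge (Nat.card V) (i + 1) with h1 | h1
  · rw [num_gt G h1]; simp
  rcases Nat.lt_or_ge (Nat.card V) (i + 3) with h2 | h2
  · have h3 : i + 1 = Nat.card V ∨ i + 2 = Nat.card V := by omega
    rcases h3 with h3 | h3
    · rw [num_eq G (i := i - 1) (k := 2) (by omega), num_eq G (i := i + 1) (k := 0) (by omega),
        num_eq G (i := i) (k := 1) (by omega)]
      exact count02
    · rw [num_eq G (i := i - 1) (k := 3) (by omega), num_eq G (i := i + 1) (k := 1) (by omega),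
        num_eq G (i := i) (k := 2) (by omega)]
      exact count13 (no_fam4 G h)
  · rw [num_lt G h (i := i - 1) (by omega)]; simp
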